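/- Under conditions (B1)–(B4) and the additional condition k^{1/α+1/2}/d(n) = o(n^{−ν}) for some ν > 0, for all real numbers c < d, k^{−1/2} sup_{x ∈ [c,d]} Σ_{i=1}^n | (log Z_i − log b*(n/k) + x)_+ − (log Ẑ_i − log b*(n/k) + x)_+ | converges to 0 in probability as n → ∞. -/

import Mathlib

open MeasureTheory ProbabilityTheory Filter Set
open scoped ProbabilityTheory

noncomputable section

namespace TailCusum

variable {Ω : Type*} [MeasureSpace Ω]

/-- `φ₁(x) = 1{x > 0}`. -/
def phi1 (x : ℝ) : ℝ := if 0 < x then 1 else 0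

/-- `φ₂(x) = x₊ = max {x, 0}`. -/
def phi2 (x : ℝ) : ℝ := max x 0

/-- positive part -/
def pos (x : ℝ) : ℝ := max x 0

/-- A positive measurable function `g` is regularly varying at `∞` with index `ρ` if
`g(λ x)/g(x) → λ^ρ` as `x → ∞` for every `λ > 0`. -/
def RegularlyVarying (g : ℝ → ℝ) (ρ : ℝ) : Prop :=
  Measurable g ∧ ∀ lam : ℝ, 0 < lam →
    Tendsto (fun x => g (lam * x) / g x) atTop (nhds (lam ^ ρ))

/-- `l` is slowly varying at `∞`. -/
def SlowlyVarying (l : ℝ → ℝ) : Prop :=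
  Measurable l ∧ ∀ lam : ℝ, 0 < lam →
    Tendsto (fun x => l (lam * x) / l x) atTop (nhds 1)

/-- `κ(λ) = K ∫_1^λ t^(γ-1) dt`. -/
def kappaFun (K γ : ℝ) (lam : ℝ) : ℝ := K * ∫ t in (1:ℝ)..lam, t ^ (γ - 1)

/-- Second-order regular variation condition on the slowly varying function `l`
(the core of condition (A2)): `(l(λx)/l(x) - 1)/g(x) → κ(λ)` with
`κ(λ) = K ∫_1^λ t^(γ-1) dt`, `g` positive and regularly varying with index `γ ≤ 0`. -/
def SecondOrderRV (l g : ℝ → ℝ) (K γ : ℝ) : Prop :=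
  γ ≤ 0 ∧ (∀ x, 0 < g x) ∧ RegularlyVarying g γ ∧
  ∀ lam : ℝ, 0 < lam →
    Tendsto (fun x => (l (lam * x) / l x - 1) / g x) atTop (nhds (kappaFun K γ lam))

/-- distribution function of a law on `ℝ` -/
def df (μ : Measure ℝ) (x : ℝ) : ℝ := (μ (Iic x)).toReal

/-- tail distribution function `F̄(x) = μ(x, ∞)` -/
def tailDF (μ : Measure ℝ) (x : ℝ) : ℝ := (μ (Ioi x)).toReal

/-- the quantile-type function `b(x) = inf {y : F(y) ≥ 1 - x⁻¹}` -/
def quantileB (μ : Measure ℝ) (x : ℝ) : ℝ := sInf {y : ℝ | 1 - x⁻¹ ≤ df μ y}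

/-- `F̄(x) = x^(-α) l(x)` for `x > 0` with `l` slowly varying: Pareto-type tail. -/
def ParetoTail (μ : Measure ℝ) (α : ℝ) (l : ℝ → ℝ) : Prop :=
  SlowlyVarying l ∧ ∀ x : ℝ, 0 < x → tailDF μ x = x ^ (-α) * l x

/-- strict stationarity of a sequence of random variables -/
def IsStationary (X : ℕ → Ω → ℝ) : Prop :=
  ∀ j : ℕ,
    Measure.map (fun ω => fun i : ℕ => X (i + j) ω) (ℙ : Measure Ω)
      = Measure.map (fun ω => fun i : ℕ => X i ω) (ℙ : Measure Ω)

/-- strict stationarity, `ℤ`-indexed -/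
def IsStationaryZ (X : ℤ → Ω → ℝ) : Prop :=
  ∀ j : ℤ,
    Measure.map (fun ω => fun i : ℤ => X (i + j) ω) (ℙ : Measure Ω)
      = Measure.map (fun ω => fun i : ℤ => X i ω) (ℙ : Measure Ω)

/-- The β-mixing coefficient of the sequence `X` at lag `lag`, expressed as
the supremum over `m` of the total-variation distance between the joint law of
`(X_1, …, X_m)` and `(X_{m+lag+1}, X_{m+lag+2}, …)` and the product of the two laws. -/
def betaMix (X : ℕ → Ω → ℝ) (lag : ℕ) : ℝ :=
  ⨆ m : ℕ, ⨆ S : Subtype (MeasurableSet : Set ((Fin m → ℝ) × (ℕ → ℝ)) → Prop),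
    |((Measure.map
        (fun ω => ((fun i : Fin m => X ((i : ℕ) + 1) ω, fun i : ℕ => X (m + lag + 1 + i) ω)))
        (ℙ : Measure Ω)) S.1).toReal
      - (((Measure.map (fun ω => fun i : Fin m => X ((i : ℕ) + 1) ω) (ℙ : Measure Ω)).prod
          (Measure.map (fun ω => fun i : ℕ => X (m + lag + 1 + i) ω) (ℙ : Measure Ω))) S.1).toReal|

/-- The tail sample fraction condition: `k → ∞` and `k = o(n)`. -/
def TailFraction (k : ℕ → ℕ) : Prop :=
  Tendsto (fun n : ℕ => (k n : ℝ)) atTop atTop ∧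
    Tendsto (fun n : ℕ => (k n : ℝ) / n) atTop (nhds 0)

/-- Condition (A1): `(n / r_n) β([ε r_n]) → 0` for every `ε > 0`, and `r_n² = o(k)`. -/
def CondA1 (X : ℕ → Ω → ℝ) (k r : ℕ → ℕ) : Prop :=
  (∀ n, 0 < r n) ∧
  (∀ ε : ℝ, 0 < ε →
    Tendsto (fun n : ℕ => ((n : ℝ) / r n) * betaMix X ⌊ε * r n⌋₊) atTop (nhds 0)) ∧
  Tendsto (fun n : ℕ => ((r n : ℝ) ^ 2 / k n)) atTop (nhds 0)

/-- Condition (A2): second-order regular variation of `l` plus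
`√k · g(b(n/k)) → A ∈ ℝ`. -/
def CondA2 (l g : ℝ → ℝ) (K γ A : ℝ) (b : ℝ → ℝ) (k : ℕ → ℕ) : Prop :=
  SecondOrderRV l g K γ ∧
    Tendsto (fun n : ℕ => Real.sqrt (k n) * g (b ((n : ℝ) / k n))) atTop (nhds A)

/-- covariance of two real random variables -/
def cov (f g : Ω → ℝ) : ℝ :=
  ∫ ω, (f ω - ∫ ω', f ω') * (g ω - ∫ ω', g ω')

/-- pairs `1 ≤ i < j ≤ N` -/
def pairsUpTo (N : ℕ) : Finset (ℕ × ℕ) :=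
  ((Finset.Icc 1 N) ×ˢ (Finset.Icc 1 N)).filter fun p => p.1 < p.2

/-- Condition (A3): existence of the limits `χ` and `ω` of the normalized sums of
covariances, for every `0 < ε < 1`. -/
def CondA3 (X : ℕ → Ω → ℝ) (b : ℝ → ℝ) (k r : ℕ → ℕ) (α χ ωc : ℝ) : Prop :=
  0 ≤ χ ∧ 0 ≤ ωc ∧
  ∀ ε : ℝ, 0 < ε → ε < 1 →
    (Tendsto (fun n : ℕ =>
        (2 * α ^ 2 * n / ((⌊ε * r n⌋₊ : ℝ) * k n)) *
          ∑ p ∈ pairsUpTo ⌊ε * r n⌋₊,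
            cov (fun ω => pos (Real.log (X p.1 ω) - Real.log (b ((n : ℝ) / k n))))
                (fun ω => pos (Real.log (X p.2 ω) - Real.log (b ((n : ℝ) / k n)))))
      atTop (nhds χ)) ∧
    (Tendsto (fun n : ℕ =>
        (2 * (n : ℝ) / ((⌊ε * r n⌋₊ : ℝ) * k n)) *
          ∑ p ∈ pairsUpTo ⌊ε * r n⌋₊,
            cov (fun ω => if b ((n : ℝ) / k n) < X p.1 ω then (1 : ℝ) else 0)
                (fun ω => if b ((n : ℝ) / k n) < X p.2 ω then (1 : ℝ) else 0))
      atTop (nhds ωc))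

/-- the `k`-th largest value among `X_1, …, X_n` -/
def orderStat (n k : ℕ) (X : ℕ → Ω → ℝ) (ω : Ω) : ℝ :=
  sInf {x : ℝ | ((Finset.Icc 1 n).filter fun i => x < X i ω).card < k}

/-- `|Σ_{i=1}^l Y_i - (l/n) Σ_{i=1}^n Y_i|` -/
def cusumAt (n : ℕ) (Y : ℕ → ℝ) (l : ℕ) : ℝ :=
  |∑ i ∈ Finset.Icc 1 l, Y i - ((l : ℝ) / n) * ∑ i ∈ Finset.Icc 1 n, Y i|

/-- The cusum statistic `T_n(φ)` with random threshold `X_(k)`. -/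
def cusum (n k : ℕ) (X : ℕ → Ω → ℝ) (φ : ℝ → ℝ) (ω : Ω) : ℝ :=
  (Real.sqrt k)⁻¹ *
    ⨆ l ∈ Finset.Icc 1 n,
      cusumAt n (fun i => φ (Real.log (X i ω) - Real.log (orderStat n k X ω))) l

/-- The cusum statistic with deterministic threshold `b(n/k)`. -/
def cusumDet (n k : ℕ) (X : ℕ → Ω → ℝ) (φ : ℝ → ℝ) (b : ℝ → ℝ) (ω : Ω) : ℝ :=
  (Real.sqrt k)⁻¹ *
    ⨆ l ∈ Finset.Icc 1 n,
      cusumAt n (fun i => φ (Real.log (X i ω) - Real.log (b ((n : ℝ) / k)))) l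

/-- convergence in distribution (weak convergence of laws) of real random variables to
a real random variable `Z` defined on a possibly different probability space -/
def TendstoInDist {Ω' : Type*} [MeasureSpace Ω'] (Y : ℕ → Ω → ℝ) (Z : Ω' → ℝ) : Prop :=
  ∀ f : ℝ → ℝ, Continuous f → (∃ C, ∀ x, |f x| ≤ C) →
    Tendsto (fun n : ℕ => ∫ ω, f (Y n ω)) atTop (nhds (∫ ω, f (Z ω)))

/-- convergence in distribution to a law `μ` on `ℝ` -/
def TendstoInLaw (Y : ℕ → Ω → ℝ) (μ : Measure ℝ) : Prop :=
  ∀ f : ℝ → ℝ, Continuous f → (∃ C, ∀ x, |f x| ≤ C) →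
    Tendsto (fun n : ℕ => ∫ ω, f (Y n ω)) atTop (nhds (∫ x, f x ∂μ))

/-- bounded in probability (`O_P(1)`) -/
def BddInProb (Y : ℕ → Ω → ℝ) : Prop :=
  ∀ ε : ℝ, 0 < ε → ∃ C : ℝ, ∀ᶠ n in atTop,
    ((ℙ : Measure Ω) {ω | C < |Y n ω|}).toReal < ε

/-- divergence to `+∞` in probability -/
def DivergesInProb (Y : ℕ → Ω → ℝ) : Prop :=
  ∀ C : ℝ, Tendsto (fun n : ℕ => ((ℙ : Measure Ω) {ω | Y n ω ≤ C}).toReal) atTop (nhds 0)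

/-- standard Brownian motion on `[0, ∞)` -/
structure IsStdBrownianMotion {Ω' : Type*} [MeasureSpace Ω'] (B : ℝ → Ω' → ℝ) : Prop where
  isProb : IsProbabilityMeasure (ℙ : Measure Ω')
  meas : ∀ t, Measurable (B t)
  start : ∀ᵐ ω ∂(ℙ : Measure Ω'), B 0 ω = 0
  gauss_incr : ∀ s t : ℝ, 0 ≤ s → s ≤ t →
    Measure.map (fun ω => B t ω - B s ω) (ℙ : Measure Ω')
      = gaussianReal 0 (Real.toNNReal (t - s))
  indep_incr : ∀ (n : ℕ) (ts : ℕ → ℝ), (∀ i, 0 ≤ ts i) → Monotone ts →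
    iIndepFun (m := fun _ => Real.measurableSpace)
      (fun i : Fin n => fun ω => B (ts ((i : ℕ) + 1)) ω - B (ts (i : ℕ)) ω)
      (ℙ : Measure Ω')

/-- `sup_{0 ≤ t ≤ 1} |B°(t)|` where `B°(t) = B(t) - t B(1)` is the Brownian bridge
associated with the Brownian motion `B` -/
def supAbsBrownianBridge {Ω' : Type*} [MeasureSpace Ω'] (B : ℝ → Ω' → ℝ) (ω : Ω') : ℝ :=
  ⨆ t : Icc (0 : ℝ) 1, |B (t : ℝ) ω - (t : ℝ) * B 1 ω|

/-- `A_i(ζ) = φ(log X_i - log b(n/k) + ζ/√k)` -/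
def An (X : ℕ → Ω → ℝ) (b : ℝ → ℝ) (φ : ℝ → ℝ) (n k : ℕ) (ζ : ℝ) (i : ℕ) (ω : Ω) : ℝ :=
  φ (Real.log (X i ω) - Real.log (b ((n : ℝ) / k)) + ζ / Real.sqrt k)

/-- the tail sequential process `M_n(t, ζ) = k^{-1/2} Σ_{i=1}^{[nt]} (A_i(ζ) - E A_1(ζ))` -/
def Mn (X : ℕ → Ω → ℝ) (b : ℝ → ℝ) (φ : ℝ → ℝ) (n k : ℕ) (t ζ : ℝ) (ω : Ω) : ℝ :=
  (Real.sqrt k)⁻¹ * ∑ i ∈ Finset.Icc 1 ⌊(n : ℝ) * t⌋₊,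
    (An X b φ n k ζ i ω - ∫ ω', An X b φ n k ζ 1 ω')

/-- residual `ξ̂_i = X_i - Σ_{j=1}^p φ̂_j X_{i-j}` of an AR(p) fit -/
def residual (p : ℕ) (X : ℤ → Ω → ℝ) (φh : Ω → Fin p → ℝ) (i : ℕ) (ω : Ω) : ℝ :=
  X i ω - ∑ j : Fin p, φh ω j * X ((i : ℤ) - ((j : ℕ) + 1)) ω

/-- absolute residual `Ẑ_i = |ξ̂_i|` -/
def Zhat (p : ℕ) (X : ℤ → Ω → ℝ) (φh : Ω → Fin p → ℝ) (i : ℕ) (ω : Ω) : ℝ :=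
  |residual p X φh i ω|

/-- stationarity of the restriction of `Y` to the segment of indices `[a, b]` -/
def SegStationary (a b : ℕ) (Y : ℕ → Ω → ℝ) : Prop :=
  ∀ (m : ℕ) (s : Fin m → ℕ) (j : ℕ), (∀ q, a ≤ s q ∧ s q + j ≤ b) →
    Measure.map (fun ω => fun q : Fin m => Y (s q + j) ω) (ℙ : Measure Ω)
      = Measure.map (fun ω => fun q : Fin m => Y (s q) ω) (ℙ : Measure Ω)

/-- the row-wise mixing coefficient
`β_n(l) = sup_m sup {|P(A∩B) - P(A)P(B)| : A ∈ σ(Y_i : m+l+1 ≤ i ≤ n), B ∈ σ(Y_1,…,Y_m)}` -/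
def betaMixRow (n : ℕ) (Y : ℕ → Ω → ℝ) (lag : ℕ) : ℝ :=
  ⨆ m : ℕ, ⨆ As : Subtype (MeasurableSet : Set (Fin (n - (m + lag)) → ℝ) → Prop),
    ⨆ Bs : Subtype (MeasurableSet : Set (Fin m → ℝ) → Prop),
      |((ℙ : Measure Ω)
          (((fun ω => fun i : Fin (n - (m + lag)) => Y (m + lag + 1 + (i : ℕ)) ω) ⁻¹' As.1)
            ∩ ((fun ω => fun i : Fin m => Y ((i : ℕ) + 1) ω) ⁻¹' Bs.1))).toReal
        - ((ℙ : Measure Ω)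
            ((fun ω => fun i : Fin (n - (m + lag)) => Y (m + lag + 1 + (i : ℕ)) ω) ⁻¹' As.1)).toReal
          * ((ℙ : Measure Ω)
            ((fun ω => fun i : Fin m => Y ((i : ℕ) + 1) ω) ⁻¹' Bs.1)).toReal|

open scoped Polynomial

/-- The backshift operator `(B f)_i = f_{i-1}` on complex sequences indexed by `ℤ`. -/
def backshift : Module.End ℂ (ℤ → ℂ) where
  toFun f i := f (i - 1)
  map_add' _ _ := rfl
  map_smul' _ _ := rfl

lemma backshift_pow_apply (j : ℕ) (f : ℤ → ℂ) (i : ℤ) : (backshift ^ j) f i = f (i - j) := by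
  induction j generalizing i with
  | zero => simp
  | succ j ih =>
    rw [pow_succ', Module.End.mul_apply]
    change (backshift ^ j) f (i - 1) = _
    rw [ih]
    congr 1
    push_cast
    ring

lemma aeval_backshift_apply (P : ℂ[X]) (f : ℤ → ℂ) (i : ℤ) :
    Polynomial.aeval backshift P f i = ∑ j ∈ Finset.range (P.natDegree + 1),
      P.coeff j * f (i - j) := by
  rw [Polynomial.aeval_eq_sum_range]
  simp [LinearMap.sum_apply, Finset.sum_apply, backshift_pow_apply]

lemma aeval_one_sub_backshift_apply (w : ℂ) (f : ℤ → ℂ) (i : ℤ) :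
    Polynomial.aeval backshift (1 - Polynomial.C w * Polynomial.X) f i = f i - w * f (i - 1) := by
  simp [backshift]

/-- A polynomial with constant term `1` and a root `z` is divisible by `1 - z⁻¹ X`. -/
lemma exists_eq_one_sub_mul {P : ℂ[X]} (h1 : P.eval 0 = 1) {z : ℂ} (hz : P.IsRoot z) :
    ∃ Q : ℂ[X], P = Q * (1 - Polynomial.C z⁻¹ * Polynomial.X) ∧ Q.eval 0 = 1 ∧
      P.natDegree = Q.natDegree + 1 := by
  have hz0 : z ≠ 0 := by
    rintro rfl
    rw [Polynomial.IsRoot.def, h1] at hz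
    exact one_ne_zero hz
  obtain ⟨R, hR⟩ := Polynomial.dvd_iff_isRoot.2 hz
  have hlin : (Polynomial.X - Polynomial.C z : ℂ[X])
      = Polynomial.C (-z) * (1 - Polynomial.C z⁻¹ * Polynomial.X) := by
    rw [mul_sub, ← mul_assoc, ← Polynomial.C_mul]
    simp [hz0]
    ring
  have hR0 : R ≠ 0 := by
    rintro rfl
    simp [hR] at h1
  refine ⟨Polynomial.C (-z) * R, ?_, ?_, ?_⟩
  · rw [hR, hlin]; ring
  · rw [hR] at h1
    simpa using h1
  · rw [hR, Polynomial.natDegree_mul (Polynomial.X_sub_C_ne_zero z) hR0,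
      Polynomial.natDegree_C_mul (neg_ne_zero.2 hz0), Polynomial.natDegree_X_sub_C, add_comm]

/-- If `|w| < 1`, then `f_i - w f_{i-1}` controls `f` on a window. -/
lemma norm_le_of_norm_sub_mul_le {w : ℂ} (hw : ‖w‖ < 1) (f : ℤ → ℂ) (n : ℕ) {A I : ℝ}
    (hI : 0 ≤ I) (hA : 0 ≤ A)
    (h : ∀ i : ℤ, 1 ≤ i → i ≤ n → ‖f i - w * f (i - 1)‖ ≤ A) (h0 : ‖f 0‖ ≤ I) :
    ∀ i : ℕ, i ≤ n → ‖f i‖ ≤ I + A / (1 - ‖w‖) := by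
  have hw' : 0 < 1 - ‖w‖ := by linarith
  intro i
  induction i with
  | zero =>
    intro _
    have : 0 ≤ A / (1 - ‖w‖) := by positivity
    simpa using by linarith
  | succ i ih =>
    intro hi
    have h1 := h (i + 1 : ℕ) (by push_cast; linarith [Int.natCast_nonneg i]) (by exact_mod_cast hi)
    have h2 := ih (by omega)
    have h3 : ((i + 1 : ℕ) : ℤ) - 1 = i := by push_cast; ring
    rw [h3] at h1
    have h4 : ‖f (i + 1 : ℕ)‖ ≤ ‖w‖ * ‖f i‖ + A := by
      rw [← norm_mul]
      have := norm_sub_norm_le (f (i + 1 : ℕ)) (w * f i)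
      linarith
    have h5 : ‖w‖ * ‖f i‖ ≤ ‖w‖ * (I + A / (1 - ‖w‖)) := by gcongr
    have h6 : ‖w‖ * (A / (1 - ‖w‖)) + A = A / (1 - ‖w‖) := by field_simp; ring
    have h7 : ‖w‖ * I ≤ I := by nlinarith
    linarith [mul_add ‖w‖ I (A / (1 - ‖w‖))]

/-- A solution of a stable linear recursion is bounded by its initial values and its innovations. -/
lemma exists_bound_of_stable (m : ℕ) : ∀ P : ℂ[X], P.natDegree = m → P.eval 0 = 1 →
    (∀ z : ℂ, ‖z‖ ≤ 1 → P.eval z ≠ 0) →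
    ∃ C : ℝ, 0 ≤ C ∧ ∃ N : ℕ, ∀ (f : ℤ → ℂ) (n : ℕ) (A I : ℝ), 0 ≤ A → 0 ≤ I →
      (∀ i : ℤ, 1 ≤ i → i ≤ n → ‖Polynomial.aeval backshift P f i‖ ≤ A) →
      (∀ i : ℤ, -(N : ℤ) < i → i ≤ 0 → ‖f i‖ ≤ I) →
      ∀ i : ℤ, 1 ≤ i → i ≤ n → ‖f i‖ ≤ C * (A + I) := by
  induction m with
  | zero =>
    intro P hdeg h1 _
    rw [Polynomial.natDegree_eq_zero] at hdeg
    obtain ⟨c, rfl⟩ := hdeg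
    obtain rfl : c = 1 := by simpa using h1
    refine ⟨1, zero_le_one, 0, fun f n A I hA hI h _ i hi hin => ?_⟩
    have := h i hi hin
    simp only [map_one, Module.End.one_apply] at this
    linarith
  | succ m ih =>
    intro P hdeg h1 hroot
    have hdeg' : P.degree ≠ 0 := by
      intro h
      have := Polynomial.natDegree_eq_zero_iff_degree_le_zero.2 h.le
      omega
    obtain ⟨z, hz⟩ := IsAlgClosed.exists_root P hdeg'
    have hz1 : 1 < ‖z‖ := by
      by_contra h
      exact hroot z (not_lt.1 h) hz
    obtain ⟨Q, hPQ, hQ1, hQdeg⟩ := exists_eq_one_sub_mul h1 hz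
    obtain ⟨C, hC, N, hCN⟩ := ih Q (by omega) hQ1 (fun u hu h => hroot u hu (by
      rw [hPQ, Polynomial.eval_mul, h, zero_mul]))
    have hw : ‖z⁻¹‖ < 1 := by
      rw [norm_inv]
      exact inv_lt_one_of_one_lt₀ hz1
    set w := z⁻¹
    have hw' : 0 < 1 - ‖w‖ := by linarith
    refine ⟨1 + 2 * C / (1 - ‖w‖), by positivity, N + 1, fun f n A I hA hI h hinit i hi hin => ?_⟩
    set V := Polynomial.aeval backshift (1 - Polynomial.C w * Polynomial.X) f with hV
    have hVi : ∀ i, V i = f i - w * f (i - 1) := aeval_one_sub_backshift_apply w f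
    have hV0 : ∀ i : ℤ, -(N : ℤ) < i → i ≤ 0 → ‖V i‖ ≤ 2 * I := by
      intro i hi hi0
      rw [hVi]
      have a1 := hinit i (by push_cast; linarith) hi0
      have a2 := hinit (i - 1) (by push_cast; linarith) (by linarith)
      have a3 := norm_sub_le (f i) (w * f (i - 1))
      rw [norm_mul] at a3
      nlinarith [norm_nonneg w, norm_nonneg (f (i - 1))]
    have hVb := hCN V n A (2 * I) hA (by linarith) (by
      intro i hi hin
      have := h i hi hin
      rwa [hPQ, map_mul, Module.End.mul_apply] at this) hV0
    have hb := norm_le_of_norm_sub_mul_le hw f n (A := C * (A + 2 * I)) hI (by positivity)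
      (fun i hi hin => by rw [← hVi]; exact hVb i hi hin)
      (hinit 0 (by push_cast; linarith [Int.natCast_nonneg N]) le_rfl) i.toNat (by omega)
    have hcast : ((i.toNat : ℕ) : ℤ) = i := Int.toNat_of_nonneg (by omega)
    rw [hcast] at hb
    refine hb.trans ?_
    have e : (1 + 2 * C / (1 - ‖w‖)) * (A + I)
        = I + C * (A + 2 * I) / (1 - ‖w‖) + (A + C * A / (1 - ‖w‖)) := by
      field_simp
      ring
    rw [e]
    have : 0 ≤ A + C * A / (1 - ‖w‖) := by positivity
    linarith

/-- The characteristic polynomial `1 - ∑ φ_j z^j` of an autoregression. -/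
def arPoly {p : ℕ} (φc : Fin p → ℝ) : ℂ[X] :=
  1 - ∑ j : Fin p, Polynomial.C (φc j : ℂ) * Polynomial.X ^ ((j : ℕ) + 1)

lemma arPoly_eval {p : ℕ} (φc : Fin p → ℝ) (z : ℂ) :
    (arPoly φc).eval z = 1 - ∑ j : Fin p, (φc j : ℂ) * z ^ ((j : ℕ) + 1) := by
  simp [arPoly, Polynomial.eval_finsetSum]

lemma aeval_arPoly {p : ℕ} (φc : Fin p → ℝ) (f : ℤ → ℂ) (i : ℤ) :
    Polynomial.aeval backshift (arPoly φc) f i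
      = f i - ∑ j : Fin p, (φc j : ℂ) * f (i - ((j : ℕ) + 1)) := by
  simp only [arPoly, map_sub, map_one, map_sum, map_mul, Polynomial.aeval_C, map_pow,
    Polynomial.aeval_X, LinearMap.sub_apply, Module.End.one_apply, Pi.sub_apply,
    LinearMap.sum_apply, Finset.sum_apply, Module.End.mul_apply, Module.algebraMap_end_apply,
    Pi.smul_apply, smul_eq_mul, backshift_pow_apply]
  push_cast
  rfl

lemma measurable_sum_iSup_comap {Ω' : Type*} {ζ : ℕ → Ω' → ℂ} {T : Set ℕ} {s : Finset ℕ} (hs : ∀ i ∈ s, i ∈ T) :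
    Measurable[⨆ i ∈ T, MeasurableSpace.comap (ζ i) inferInstance]
      (fun ω => ∑ i ∈ s, ζ i ω) := by
  refine @Finset.measurable_fun_sum ℂ ℕ Ω' _ _ _ (⨆ i ∈ T, MeasurableSpace.comap (ζ i) inferInstance)
    ζ s fun i hi => ?_
  exact (comap_measurable (ζ i)).mono
    (le_iSup₂ (f := fun i (_ : i ∈ T) => MeasurableSpace.comap (ζ i) inferInstance) i (hs i hi))
    le_rfl

/-- **Ottaviani's inequality** for partial sums of independent random variables. -/
lemma ottaviani_inequality [IsProbabilityMeasure (ℙ : Measure Ω)] {ζ : ℕ → Ω → ℂ}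
    (hm : ∀ i, Measurable (ζ i)) (hi : iIndepFun ζ (ℙ : Measure Ω)) (n : ℕ) {t q : ℝ}
    (h : ∀ k ≤ n, (ℙ : Measure Ω).real
      {ω | t < ‖∑ i ∈ Finset.range n, ζ i ω - ∑ i ∈ Finset.range k, ζ i ω‖} ≤ q) :
    (ℙ : Measure Ω).real {ω | ∃ k ≤ n, 2 * t < ‖∑ i ∈ Finset.range k, ζ i ω‖} * (1 - q)
      ≤ (ℙ : Measure Ω).real {ω | t < ‖∑ i ∈ Finset.range n, ζ i ω‖} := by
  set S : ℕ → Ω → ℂ := fun k ω => ∑ i ∈ Finset.range k, ζ i ω with hS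
  have hSm : ∀ k, Measurable (S k) := fun k => Finset.measurable_fun_sum _ fun i _ => hm i
  set A : ℕ → Set Ω := fun k => {ω | 2 * t < ‖S k ω‖ ∧ ∀ j < k, ‖S j ω‖ ≤ 2 * t} with hA
  set B : ℕ → Set Ω := fun k => {ω | ‖S n ω - S k ω‖ ≤ t} with hB
  have hAm' : ∀ k, MeasurableSet[⨆ i ∈ {i | i < k}, MeasurableSpace.comap (ζ i) inferInstance]
      (A k) := by
    intro k
    have hSk : ∀ j ≤ k, Measurable[⨆ i ∈ {i | i < k}, MeasurableSpace.comap (ζ i) inferInstance]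
        (fun ω => ‖S j ω‖) := fun j hj =>
      measurable_norm.comp (measurable_sum_iSup_comap fun i hi => by
        simp only [Finset.mem_range, mem_ofPred_eq] at *; omega)
    have : A k = (fun ω => ‖S k ω‖) ⁻¹' Ioi (2 * t) ∩
        ⋂ j, ⋂ (_ : j < k), (fun ω => ‖S j ω‖) ⁻¹' Iic (2 * t) := by
      ext ω; simp [hA]
    rw [this]
    exact (hSk k le_rfl measurableSet_Ioi).inter
      (MeasurableSet.iInter fun j => MeasurableSet.iInter fun hj => hSk j hj.le measurableSet_Iic)
  have hBm' : ∀ k ≤ n, MeasurableSet[⨆ i ∈ {i | k ≤ i}, MeasurableSpace.comap (ζ i) inferInstance]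
      (B k) := by
    intro k hk
    have h1 : ∀ ω, S n ω - S k ω = ∑ i ∈ Finset.Ico k n, ζ i ω := fun ω => by
      rw [Finset.sum_Ico_eq_sub _ hk]
    have : B k = (fun ω => ‖∑ i ∈ Finset.Ico k n, ζ i ω‖) ⁻¹' Iic t := by
      ext ω; simp [hB, h1]
    rw [this]
    exact (measurable_norm.comp (measurable_sum_iSup_comap (T := {i | k ≤ i}) fun i hi => by
        simp only [Finset.mem_Ico, mem_ofPred_eq] at *; omega)) measurableSet_Iic
  have hle : ∀ i, MeasurableSpace.comap (ζ i) inferInstance ≤ (inferInstance : MeasurableSpace Ω) :=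
    fun i => (hm i).comap_le
  have hAm : ∀ k, MeasurableSet (A k) := fun k => (iSup₂_le fun i _ => hle i) _ (hAm' k)
  have hBm : ∀ k ≤ n, MeasurableSet (B k) := fun k hk =>
    (iSup₂_le fun i _ => hle i) _ (hBm' k hk)
  have hAB : ∀ k ≤ n, (ℙ : Measure Ω).real (A k ∩ B k)
      = (ℙ : Measure Ω).real (A k) * (ℙ : Measure Ω).real (B k) := by
    intro k hk
    have hind := indep_iSup_of_disjoint hle hi.iIndep (S := {i | i < k}) (T := {i | k ≤ i})
      (Set.disjoint_left.2 fun i (h1 : i < k) (h2 : k ≤ i) => by omega)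
    rw [measureReal_def, (Indep_iff _ _ _).1 hind _ _ (hAm' k) (hBm' k hk), ENNReal.toReal_mul]
    rfl
  have hdis : Pairwise (Function.onFun Disjoint A) := by
    intro i j hij
    refine Set.disjoint_left.2 fun ω h1 h2 => ?_
    rcases lt_or_gt_of_ne hij with h | h
    · exact absurd h1.1 (not_lt.2 (h2.2 i h))
    · exact absurd h2.1 (not_lt.2 (h1.2 j h))
  have hunion : {ω | ∃ k ≤ n, 2 * t < ‖S k ω‖} = ⋃ k ∈ Finset.range (n + 1), A k := by
    ext ω
    simp only [mem_ofPred_eq, mem_iUnion, Finset.mem_range, exists_prop]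
    constructor
    · intro hex
      classical
      have hex' : ∃ k, 2 * t < ‖S k ω‖ := by
        obtain ⟨k, _, hk⟩ := hex
        exact ⟨k, hk⟩
      obtain ⟨k, hkn, hk⟩ := hex
      refine ⟨Nat.find hex', ?_, Nat.find_spec hex', fun j hj => ?_⟩
      · have := Nat.find_min' hex' hk
        omega
      · exact not_lt.1 (Nat.find_min hex' hj)
    · rintro ⟨k, hk, hA⟩
      exact ⟨k, by omega, hA.1⟩
  have hBq : ∀ k ≤ n, 1 - q ≤ (ℙ : Measure Ω).real (B k) := by
    intro k hk
    have h1 := h k hk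
    have h2 : {ω | t < ‖S n ω - S k ω‖} = (B k)ᶜ := by ext ω; simp [hB]
    change (ℙ : Measure Ω).real {ω | t < ‖S n ω - S k ω‖} ≤ q at h1
    rw [h2, probReal_compl_eq_one_sub (hBm k hk)] at h1
    linarith
  rw [hunion, measureReal_biUnion_finset (fun i _ j _ hij => hdis hij) (fun k _ => hAm k),
    Finset.sum_mul]
  calc ∑ k ∈ Finset.range (n + 1), (ℙ : Measure Ω).real (A k) * (1 - q)
      ≤ ∑ k ∈ Finset.range (n + 1), (ℙ : Measure Ω).real (A k ∩ B k) := by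
        refine Finset.sum_le_sum fun k hk => ?_
        have hk' : k ≤ n := by simpa [Nat.lt_succ_iff] using hk
        rw [hAB k hk']
        exact mul_le_mul_of_nonneg_left (hBq k hk') measureReal_nonneg
    _ = (ℙ : Measure Ω).real (⋃ k ∈ Finset.range (n + 1), A k ∩ B k) := by
        rw [measureReal_biUnion_finset
          (fun i _ j _ hij => (hdis hij).mono inter_subset_left inter_subset_left)]
        exact fun k hk => (hAm k).inter (hBm k (by simpa [Nat.lt_succ_iff] using hk))
    _ ≤ _ := by
        refine measureReal_mono ?_
        intro ω hω
        simp only [mem_iUnion, Finset.mem_range, exists_prop] at hω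
        obtain ⟨k, hk, h1, h2⟩ := hω
        have h3 : ‖S k ω‖ ≤ ‖S n ω‖ + ‖S n ω - S k ω‖ := by
          rw [norm_sub_rev]
          have := norm_sub_norm_le (S k ω) (S n ω)
          linarith
        have h4 := h1.1
        have h5 : ‖S n ω - S k ω‖ ≤ t := h2
        change t < ‖S n ω‖
        linarith

/-- A real random variable is tight. -/
lemma exists_measureReal_lt {Y : Ω → ℝ} [IsProbabilityMeasure (ℙ : Measure Ω)]
    (hY : Measurable Y) {ε : ℝ} (hε : 0 < ε) :
    ∃ t : ℝ, ∀ s, t ≤ s → (ℙ : Measure Ω).real {ω | s < Y ω} < ε := by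
  have hlim := tendsto_cdf_atTop ((ℙ : Measure Ω).map Y)
  have : IsProbabilityMeasure ((ℙ : Measure Ω).map Y) :=
    Measure.isProbabilityMeasure_map hY.aemeasurable
  obtain ⟨t, ht⟩ := eventually_atTop.1 (hlim.eventually (lt_mem_nhds (sub_lt_self 1 hε)))
  refine ⟨t, fun s hs => ?_⟩
  have h1 := ht s hs
  rw [cdf_eq_real, map_measureReal_apply hY measurableSet_Iic] at h1
  have h2 : {ω | s < Y ω} = (Y ⁻¹' Iic s)ᶜ := by ext; simp
  rw [h2, probReal_compl_eq_one_sub (hY measurableSet_Iic)]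
  linarith

lemma measureReal_iInter_abs_le [IsProbabilityMeasure (ℙ : Measure Ω)] {ξ : ℤ → Ω → ℝ}
    (hξmeas : ∀ i, Measurable (ξ i)) (hindep : iIndepFun ξ (ℙ : Measure Ω))
    (hident : ∀ i : ℤ, Measure.map (ξ i) (ℙ : Measure Ω) = Measure.map (ξ 1) (ℙ : Measure Ω))
    (M : ℝ) (n : ℕ) :
    (ℙ : Measure Ω).real {ω | ∀ i < n, |ξ ((i : ℤ) + 1) ω| ≤ M}
      = ((ℙ : Measure Ω).real {ω | |ξ 1 ω| ≤ M}) ^ n := by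
  have hset : MeasurableSet {x : ℝ | |x| ≤ M} := measurableSet_le measurable_norm measurable_const
  have hi : iIndepFun (fun (j : ℕ) => ξ ((j : ℤ) + 1)) (ℙ : Measure Ω) :=
    hindep.precomp (g := fun j : ℕ => (j : ℤ) + 1) (fun a b h => by simpa using h)
  have h1 : {ω | ∀ i < n, |ξ ((i : ℤ) + 1) ω| ≤ M}
      = ⋂ i ∈ Finset.range n, ξ ((i : ℤ) + 1) ⁻¹' {x : ℝ | |x| ≤ M} := by
    ext ω; simp
  rw [h1, measureReal_def,
    hi.measure_inter_preimage_eq_mul (Finset.range n) (fun _ _ => hset), ENNReal.toReal_prod]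
  rw [← Finset.card_range n, ← Finset.prod_const, Finset.card_range]
  refine Finset.prod_congr rfl fun i _ => ?_
  rw [← Measure.map_apply (hξmeas _) hset, hident, Measure.map_apply (hξmeas _) hset]
  rfl

/-- The autoregressive polynomial of a stationary autoregression with i.i.d. innovations of
unbounded support has no root on the unit circle. -/
lemma eval_ne_zero_of_isStationaryZ [IsProbabilityMeasure (ℙ : Measure Ω)] {X ξ : ℤ → Ω → ℝ}
    (hXmeas : ∀ i, Measurable (X i)) (hξmeas : ∀ i, Measurable (ξ i))
    (hstat : IsStationaryZ X) (hindep : iIndepFun ξ (ℙ : Measure Ω))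
    (hident : ∀ i : ℤ, Measure.map (ξ i) (ℙ : Measure Ω) = Measure.map (ξ 1) (ℙ : Measure Ω))
    (hunb : ∀ M : ℝ, 0 < (ℙ : Measure Ω).real {ω | M < |ξ 1 ω|})
    {P : ℂ[X]} (hP : P.eval 0 = 1)
    (hmodel : ∀ i ω, Polynomial.aeval backshift P (fun j => (X j ω : ℂ)) i = ξ i ω)
    {z : ℂ} (hz : ‖z‖ = 1) : P.eval z ≠ 0 := by
  intro hroot
  have hz0 : z ≠ 0 := by
    rintro rfl
    simp at hz
  obtain ⟨Q, hPQ, -, -⟩ := exists_eq_one_sub_mul hP hroot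
  set V : ℤ → Ω → ℂ := fun i ω => Polynomial.aeval backshift Q (fun j => (X j ω : ℂ)) i with hV
  have hVsum : ∀ i ω, V i ω
      = ∑ j ∈ Finset.range (Q.natDegree + 1), Q.coeff j * (X (i - j) ω : ℂ) := fun i ω =>
    aeval_backshift_apply Q _ i
  have hVrec : ∀ i ω, V i ω - z⁻¹ * V (i - 1) ω = ξ i ω := by
    intro i ω
    rw [← hmodel i ω, hPQ, mul_comm Q, map_mul, Module.End.mul_apply, aeval_one_sub_backshift_apply]
  have hVm : ∀ i, Measurable (V i) := by
    intro i
    have : V i = fun ω => ∑ j ∈ Finset.range (Q.natDegree + 1), Q.coeff j * (X (i - j) ω : ℂ) :=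
      funext (hVsum i)
    rw [this]
    exact Finset.measurable_fun_sum _ fun j _ =>
      (Complex.measurable_ofReal.comp (hXmeas _)).const_mul _
  have hVlaw : ∀ (i : ℤ) (t : ℝ), (ℙ : Measure Ω).real {ω | t < ‖V i ω‖}
      = (ℙ : Measure Ω).real {ω | t < ‖V 0 ω‖} := by
    intro i t
    set F : (ℤ → ℝ) → ℂ := fun x => ∑ j ∈ Finset.range (Q.natDegree + 1), Q.coeff j * (x (-j) : ℂ)
      with hF
    have hFm : Measurable F := Finset.measurable_fun_sum _ fun j _ =>
      (Complex.measurable_ofReal.comp (measurable_pi_apply _)).const_mul _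
    have hs : MeasurableSet {x : ℤ → ℝ | t < ‖F x‖} := measurableSet_lt measurable_const hFm.norm
    have key : ∀ i : ℤ, (ℙ : Measure Ω).real {ω | t < ‖V i ω‖}
        = (Measure.map (fun ω => fun j : ℤ => X (j + i) ω) (ℙ : Measure Ω)).real
          {x | t < ‖F x‖} := by
      intro i
      rw [map_measureReal_apply (measurable_pi_lambda _ fun j => hXmeas _) hs]
      congr 1
      ext ω
      simp only [mem_ofPred_eq, mem_preimage, hVsum, hF]
      simp only [neg_add_eq_sub]
    rw [key i, key 0, hstat i, hstat 0]
  set ζ : ℕ → Ω → ℂ := fun j ω => z ^ (j + 1) * (ξ ((j : ℤ) + 1) ω : ℂ) with hζ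
  have hS : ∀ n ω, ∑ j ∈ Finset.range n, ζ j ω = z ^ n * V n ω - V 0 ω := by
    intro n ω
    induction n with
    | zero => simp
    | succ n ih =>
      rw [Finset.sum_range_succ, ih, hζ]
      simp only
      rw [← hVrec]
      have : ((n : ℤ) + 1 - 1) = n := by ring
      rw [this]
      push_cast
      field_simp
      ring
  have hζm : ∀ j, Measurable (ζ j) := fun j =>
    (Complex.measurable_ofReal.comp (hξmeas _)).const_mul _
  have hζi : iIndepFun ζ (ℙ : Measure Ω) :=
    (hindep.precomp (g := fun j : ℕ => (j : ℤ) + 1) (fun a b h => by simpa using h)).comp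
      (fun j x => z ^ (j + 1) * (x : ℂ))
      (fun j => Complex.measurable_ofReal.const_mul _)
  obtain ⟨t, ht⟩ := exists_measureReal_lt (hVm 0).norm (ε := 1 / 16) (by norm_num)
  have hsmall : ∀ n k : ℕ, (ℙ : Measure Ω).real
      {ω | 2 * t < ‖∑ i ∈ Finset.range n, ζ i ω - ∑ i ∈ Finset.range k, ζ i ω‖} ≤ 1 / 8 := by
    intro n k
    have hsub : {ω | 2 * t < ‖∑ i ∈ Finset.range n, ζ i ω - ∑ i ∈ Finset.range k, ζ i ω‖}
        ⊆ {ω | t < ‖V n ω‖} ∪ {ω | t < ‖V k ω‖} := by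
      intro ω hω
      simp only [mem_ofPred_eq, hS, mem_union] at hω ⊢
      by_contra hcon
      push Not at hcon
      have e : z ^ n * V n ω - V 0 ω - (z ^ k * V k ω - V 0 ω) = z ^ n * V n ω - z ^ k * V k ω := by
        ring
      rw [e] at hω
      have := norm_sub_le (z ^ n * V n ω) (z ^ k * V k ω)
      simp only [norm_mul, norm_pow, hz, one_pow, one_mul] at this
      linarith
    refine (measureReal_mono hsub).trans ((measureReal_union_le _ _).trans ?_)
    rw [hVlaw, hVlaw k]
    linarith [ht t le_rfl]
  have hmax : ∀ n : ℕ, (ℙ : Measure Ω).real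
      {ω | ∃ k ≤ n, 2 * (2 * t) < ‖∑ i ∈ Finset.range k, ζ i ω‖} ≤ 1 / 7 := by
    intro n
    have h1 := ottaviani_inequality hζm hζi n (t := 2 * t) (fun k _ => hsmall n k)
    have h2 := hsmall n 0
    simp only [Finset.range_zero, Finset.sum_empty, sub_zero] at h2
    linarith
  have hcover : ∀ n : ℕ, (6 / 7 : ℝ) ≤ ((ℙ : Measure Ω).real {ω | |ξ 1 ω| ≤ 8 * t}) ^ n := by
    intro n
    rw [← measureReal_iInter_abs_le hξmeas hindep hident]
    have hsub : (univ : Set Ω) ⊆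
        {ω | ∃ k ≤ n, 2 * (2 * t) < ‖∑ i ∈ Finset.range k, ζ i ω‖} ∪
        {ω | ∀ i < n, |ξ ((i : ℤ) + 1) ω| ≤ 8 * t} := by
      intro ω _
      by_cases hω : ∃ k ≤ n, 2 * (2 * t) < ‖∑ i ∈ Finset.range k, ζ i ω‖
      · exact Or.inl hω
      · right
        push Not at hω
        intro i hi
        have h1 := hω (i + 1) (by omega)
        have h2 := hω i (by omega)
        have h3 : ‖ζ i ω‖ = |ξ ((i : ℤ) + 1) ω| := by simp [hζ, hz]
        rw [← h3]
        rw [Finset.sum_range_succ] at h1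
        have := norm_sub_le (∑ j ∈ Finset.range i, ζ j ω + ζ i ω) (∑ j ∈ Finset.range i, ζ j ω)
        rw [add_sub_cancel_left] at this
        linarith
    have h1 := (measureReal_mono (μ := (ℙ : Measure Ω)) hsub).trans (measureReal_union_le _ _)
    rw [probReal_univ] at h1
    linarith [hmax n]
  have hr : (ℙ : Measure Ω).real {ω | |ξ 1 ω| ≤ 8 * t} < 1 := by
    have hms : MeasurableSet {ω | 8 * t < |ξ 1 ω|} :=
      measurableSet_lt measurable_const (hξmeas 1).norm
    have h1 : {ω | |ξ 1 ω| ≤ 8 * t} = {ω | 8 * t < |ξ 1 ω|}ᶜ := by ext; simp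
    rw [h1, probReal_compl_eq_one_sub hms]
    linarith [hunb (8 * t)]
  obtain ⟨n, hn⟩ := exists_pow_lt_of_lt_one (by norm_num : (0 : ℝ) < 6 / 7) hr
  exact absurd (hcover n) (not_le.2 hn)

section Tail

variable {μ : Measure ℝ} [IsProbabilityMeasure μ] {α : ℝ} {l : ℝ → ℝ}

lemma tailDF_nonneg (μ : Measure ℝ) (x : ℝ) : 0 ≤ tailDF μ x := ENNReal.toReal_nonneg

lemma tailDF_le_one (x : ℝ) : tailDF μ x ≤ 1 := measureReal_le_one

lemma tailDF_antitone : Antitone (tailDF μ) := fun _ _ hxy =>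
  measureReal_mono (μ := μ) (Ioi_subset_Ioi hxy)

lemma df_eq_one_sub_tailDF (x : ℝ) : df μ x = 1 - tailDF μ x := by
  have h : (Iic x : Set ℝ) = (Ioi x)ᶜ := by ext; simp
  change μ.real (Iic x) = 1 - μ.real (Ioi x)
  rw [h, probReal_compl_eq_one_sub measurableSet_Ioi]

omit [IsProbabilityMeasure μ] in
lemma ParetoTail.tendsto_ratio (h : ParetoTail μ α l) {lam : ℝ} (hlam : 0 < lam) :
    Tendsto (fun x => tailDF μ (lam * x) / tailDF μ x) atTop (nhds (lam ^ (-α))) := by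
  have h1 := (h.1.2 lam hlam).const_mul (lam ^ (-α))
  rw [mul_one] at h1
  refine h1.congr' ?_
  filter_upwards [eventually_gt_atTop 0] with x hx
  rw [h.2 x hx, h.2 (lam * x) (mul_pos hlam hx), Real.mul_rpow hlam.le hx.le]
  have : x ^ (-α) ≠ 0 := (Real.rpow_pos_of_pos hx _).ne'
  rw [mul_assoc, mul_left_comm, mul_div_mul_left _ _ this, mul_div_assoc]

lemma ParetoTail.tailDF_pos (h : ParetoTail μ α l) (x : ℝ) : 0 < tailDF μ x := by
  have h1 := (h.tendsto_ratio (lam := 1) one_pos).eventually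
    (lt_mem_nhds (Real.rpow_pos_of_pos one_pos (-α)))
  obtain ⟨y, hy, hxy⟩ := (h1.and (eventually_ge_atTop x)).exists
  refine lt_of_lt_of_le ?_ (tailDF_antitone hxy)
  refine lt_of_le_of_ne (tailDF_nonneg μ y) fun h0 => ?_
  rw [← h0, div_zero] at hy
  exact lt_irrefl _ hy

lemma ParetoTail.exists_le_rpow (h : ParetoTail μ α l) {β : ℝ} (hβ0 : 0 < β) (hβ : β < α) :
    ∃ C : ℝ, 0 < C ∧ ∀ᶠ x in atTop, tailDF μ x ≤ C * x ^ (-β) := by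
  have h2 : (2 : ℝ) ^ (-α) < 2 ^ (-β) := Real.rpow_lt_rpow_of_exponent_lt one_lt_two (by linarith)
  obtain ⟨x₁, hx₁⟩ := eventually_atTop.1 ((h.tendsto_ratio two_pos).eventually (gt_mem_nhds h2))
  set x₀ := max x₁ 1
  have hx₀ : 0 < x₀ := lt_of_lt_of_le one_pos (le_max_right _ _)
  have hstep : ∀ x, x₀ ≤ x → tailDF μ (2 * x) ≤ 2 ^ (-β) * tailDF μ x := fun x hx =>
    ((div_lt_iff₀ (h.tailDF_pos x)).1 (hx₁ x ((le_max_left _ _).trans hx))).le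
  have hiter : ∀ m : ℕ, tailDF μ (2 ^ m * x₀) ≤ ((2 : ℝ) ^ m) ^ (-β) := by
    intro m
    induction m with
    | zero => simpa using tailDF_le_one (μ := μ) x₀
    | succ m ih =>
      have h3 : x₀ ≤ 2 ^ m * x₀ := le_mul_of_one_le_left hx₀.le (one_le_pow₀ one_le_two)
      have h4 := hstep _ h3
      rw [pow_succ', mul_assoc, Real.mul_rpow two_pos.le (by positivity)]
      exact h4.trans (mul_le_mul_of_nonneg_left ih (by positivity))
  refine ⟨(2 * x₀) ^ β, by positivity, ?_⟩
  filter_upwards [eventually_ge_atTop x₀] with x hx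
  obtain ⟨m, hm1, hm2⟩ := exists_nat_pow_near ((one_le_div hx₀).2 hx) one_lt_two
  have hxp : 0 < x := hx₀.trans_le hx
  calc tailDF μ x ≤ tailDF μ (2 ^ m * x₀) := tailDF_antitone ((le_div_iff₀ hx₀).1 hm1)
    _ ≤ ((2 : ℝ) ^ m) ^ (-β) := hiter m
    _ ≤ (x / (2 * x₀)) ^ (-β) := by
        refine Real.rpow_le_rpow_of_nonpos (by positivity) ?_ (by linarith)
        rw [div_le_iff₀ (by positivity)]
        rw [div_lt_iff₀ hx₀, pow_succ] at hm2
        linarith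
    _ = (2 * x₀) ^ β * x ^ (-β) := by
        rw [Real.div_rpow hxp.le (by positivity), Real.rpow_neg (x := 2 * x₀) (by positivity)]
        field_simp

lemma ParetoTail.exists_rpow_le (h : ParetoTail μ α l) (hα : 0 < α) {β : ℝ} (hβ : α < β) :
    ∃ c : ℝ, 0 < c ∧ ∀ᶠ x in atTop, c * x ^ (-β) ≤ tailDF μ x := by
  have h2 : (2 : ℝ) ^ (-β) < 2 ^ (-α) := Real.rpow_lt_rpow_of_exponent_lt one_lt_two (by linarith)
  obtain ⟨x₁, hx₁⟩ := eventually_atTop.1 ((h.tendsto_ratio two_pos).eventually (lt_mem_nhds h2))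
  set x₀ := max x₁ 1
  have hx₀ : 0 < x₀ := lt_of_lt_of_le one_pos (le_max_right _ _)
  have hstep : ∀ x, x₀ ≤ x → 2 ^ (-β) * tailDF μ x ≤ tailDF μ (2 * x) := fun x hx =>
    ((lt_div_iff₀ (h.tailDF_pos x)).1 (hx₁ x ((le_max_left _ _).trans hx))).le
  have hiter : ∀ m : ℕ, ((2 : ℝ) ^ m) ^ (-β) * tailDF μ x₀ ≤ tailDF μ (2 ^ m * x₀) := by
    intro m
    induction m with
    | zero => simp
    | succ m ih =>
      have h3 : x₀ ≤ 2 ^ m * x₀ := le_mul_of_one_le_left hx₀.le (one_le_pow₀ one_le_two)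
      have h4 := hstep _ h3
      rw [pow_succ', mul_assoc, Real.mul_rpow two_pos.le (by positivity), mul_assoc]
      exact (mul_le_mul_of_nonneg_left ih (by positivity)).trans h4
  have hpos := h.tailDF_pos x₀
  refine ⟨(2 / x₀) ^ (-β) * tailDF μ x₀, by positivity, ?_⟩
  filter_upwards [eventually_ge_atTop x₀] with x hx
  obtain ⟨m, hm1, hm2⟩ := exists_nat_pow_near ((one_le_div hx₀).2 hx) one_lt_two
  have hxp : 0 < x := hx₀.trans_le hx
  calc (2 / x₀) ^ (-β) * tailDF μ x₀ * x ^ (-β) = (2 / x₀ * x) ^ (-β) * tailDF μ x₀ := by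
        rw [Real.mul_rpow (by positivity) hxp.le]; ring
    _ ≤ ((2 : ℝ) ^ (m + 1)) ^ (-β) * tailDF μ x₀ := by
        refine mul_le_mul_of_nonneg_right
          (Real.rpow_le_rpow_of_nonpos (by positivity) ?_ (by linarith)) hpos.le
        rw [pow_succ]
        calc (2 : ℝ) ^ m * 2 ≤ x / x₀ * 2 := by gcongr
          _ = 2 / x₀ * x := by ring
    _ ≤ tailDF μ (2 ^ (m + 1) * x₀) := hiter _
    _ ≤ tailDF μ x := tailDF_antitone ((div_lt_iff₀ hx₀).1 hm2).le

lemma ParetoTail.tendsto_nat_mul_tailDF (h : ParetoTail μ α l) (hα : 0 < α) {s : ℝ}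
    (hs : 1 / α < s) :
    Tendsto (fun n : ℕ => (n : ℝ) * tailDF μ ((n : ℝ) ^ s)) atTop (nhds 0) := by
  have hs0 : 0 < s := lt_trans (by positivity) hs
  have h1 : 1 / s < α := (one_div_lt hα hs0).1 hs
  obtain ⟨β, hβ1, hβ2⟩ := exists_between h1
  have hβ0 : 0 < β := lt_trans (by positivity) hβ1
  obtain ⟨C, hC, hCx⟩ := h.exists_le_rpow hβ0 hβ2
  have hsβ : 0 < s * β - 1 := by
    have := (div_lt_iff₀ hs0).1 hβ1
    linarith
  have hlim : Tendsto (fun n : ℕ => C * (n : ℝ) ^ (-(s * β - 1))) atTop (nhds 0) := by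
    simpa using ((tendsto_rpow_neg_atTop hsβ).comp tendsto_natCast_atTop_atTop).const_mul C
  refine squeeze_zero' (Eventually.of_forall fun n =>
    mul_nonneg n.cast_nonneg (tailDF_nonneg _ _)) ?_ hlim
  filter_upwards [((tendsto_rpow_atTop hs0).comp tendsto_natCast_atTop_atTop).eventually hCx,
    eventually_gt_atTop 0] with n hn hn0
  have hn' : (0 : ℝ) < n := by exact_mod_cast hn0
  simp only [Function.comp] at hn
  calc (n : ℝ) * tailDF μ ((n : ℝ) ^ s) ≤ n * (C * ((n : ℝ) ^ s) ^ (-β)) := by gcongr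
    _ = C * (n : ℝ) ^ (-(s * β - 1)) := by
      rw [← Real.rpow_mul hn'.le, show -(s * β - 1) = 1 + s * -β by ring, Real.rpow_add hn',
        Real.rpow_one]
      ring

lemma quantileB_set_nonempty {x : ℝ} (hx : 0 < x) : {y : ℝ | 1 - x⁻¹ ≤ df μ y}.Nonempty := by
  have hlim := (tendsto_cdf_atTop μ).eventually (lt_mem_nhds (sub_lt_self 1 (inv_pos.2 hx)))
  obtain ⟨y, hy⟩ := hlim.exists
  rw [cdf_eq_real] at hy
  exact ⟨y, hy.le⟩

lemma le_quantileB {x v : ℝ} (hx : 0 < x) (hv : x⁻¹ < tailDF μ v) : v ≤ quantileB μ x := by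
  refine le_csInf (quantileB_set_nonempty hx) fun y (hy : 1 - x⁻¹ ≤ df μ y) => ?_
  rw [df_eq_one_sub_tailDF] at hy
  by_contra hlt
  have := tailDF_antitone (μ := μ) (not_le.1 hlt).le
  linarith

lemma tailDF_le_inv_of_quantileB_lt {x v : ℝ} (hx : 0 < x) (hv : quantileB μ x < v) :
    tailDF μ v ≤ x⁻¹ := by
  obtain ⟨y, hy, hyv⟩ := exists_lt_of_csInf_lt (quantileB_set_nonempty (μ := μ) hx) hv
  have hy' : 1 - x⁻¹ ≤ df μ y := hy
  rw [df_eq_one_sub_tailDF] at hy'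
  have := tailDF_antitone (μ := μ) hyv.le
  linarith

lemma ParetoTail.eventually_rpow_le_quantileB (h : ParetoTail μ α l) (hα : 0 < α) {β : ℝ}
    (hβ0 : 0 < β) (hβ : β < 1 / α) : ∀ᶠ y in atTop, y ^ β ≤ quantileB μ y := by
  have h1 : α < 1 / β := (lt_one_div hβ0 hα).1 hβ
  obtain ⟨a, ha1, ha2⟩ := exists_between h1
  obtain ⟨c, hc, hcx⟩ := h.exists_rpow_le hα ha1
  have hpos : 0 < 1 - β * a := by
    have := (lt_div_iff₀ hβ0).1 ha2
    linarith
  filter_upwards [(tendsto_rpow_atTop hβ0).eventually hcx, eventually_gt_atTop 0,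
    (tendsto_rpow_atTop hpos).eventually (eventually_gt_atTop c⁻¹)] with y hy1 hy0 hy2
  refine le_quantileB hy0 (lt_of_lt_of_le ?_ hy1)
  rw [← Real.rpow_mul hy0.le]
  rw [sub_eq_add_neg, Real.rpow_add hy0, Real.rpow_one, ← mul_neg] at hy2
  rw [inv_lt_iff_one_lt_mul₀ hy0]
  rw [inv_lt_iff_one_lt_mul₀ hc] at hy2
  linarith

lemma ParetoTail.tendsto_quantileB (h : ParetoTail μ α l) (hα : 0 < α) :
    Tendsto (quantileB μ) atTop atTop := by
  obtain ⟨β, hβ0, hβ⟩ := exists_between (show (0 : ℝ) < 1 / α by positivity)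
  exact tendsto_atTop_mono' _ (h.eventually_rpow_le_quantileB hα hβ0 hβ) (tendsto_rpow_atTop hβ0)

lemma ParetoTail.exists_mul_tailDF_quantileB_le (h : ParetoTail μ α l) (hα : 0 < α) {δ : ℝ}
    (hδ : 0 < δ) : ∃ C : ℝ, 0 < C ∧ ∀ᶠ y in atTop, y * tailDF μ (δ * quantileB μ y) ≤ C := by
  have hδ2 : 0 < δ / 2 := by positivity
  have hq := h.tendsto_quantileB hα
  have h1 := (h.tendsto_ratio hδ2).eventually
    (gt_mem_nhds (lt_add_one ((δ / 2) ^ (-α))))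
  refine ⟨(δ / 2) ^ (-α) + 1, by positivity, ?_⟩
  filter_upwards [(hq.const_mul_atTop two_pos).eventually h1, hq.eventually (eventually_gt_atTop 0),
    eventually_gt_atTop 0] with y hy hb hy0
  rw [div_lt_iff₀ (h.tailDF_pos _), show δ / 2 * (2 * quantileB μ y) = δ * quantileB μ y by ring]
    at hy
  have h2 : tailDF μ (2 * quantileB μ y) ≤ y⁻¹ := tailDF_le_inv_of_quantileB_lt hy0 (by linarith)
  calc y * tailDF μ (δ * quantileB μ y)
      ≤ y * (((δ / 2) ^ (-α) + 1) * tailDF μ (2 * quantileB μ y)) := by gcongr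
    _ ≤ y * (((δ / 2) ^ (-α) + 1) * y⁻¹) := by gcongr
    _ = (δ / 2) ^ (-α) + 1 := by field_simp

end Tail

lemma abs_log_sub_log_le {u v θ : ℝ} (hθ : 0 < θ) (hu : θ ≤ u) (hv : θ ≤ v) :
    |Real.log u - Real.log v| ≤ |u - v| / θ := by
  have key : ∀ {u v : ℝ}, θ ≤ u → θ ≤ v → Real.log u - Real.log v ≤ |u - v| / θ := by
    intro u v hu hv
    have hu0 := hθ.trans_le hu
    have hv0 := hθ.trans_le hv
    rw [← Real.log_div hu0.ne' hv0.ne']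
    calc Real.log (u / v) ≤ u / v - 1 := Real.log_le_sub_one_of_pos (by positivity)
      _ = (u - v) / v := by field_simp
      _ ≤ |u - v| / v := by gcongr; exact le_abs_self _
      _ ≤ |u - v| / θ := by gcongr
  rw [abs_le']
  refine ⟨key hu hv, ?_⟩
  rw [neg_sub, abs_sub_comm]
  exact key hv hu

lemma pos_log_sub_log {y θ : ℝ} (hy : 0 ≤ y) (hθ : 1 ≤ θ) :
    pos (Real.log y - Real.log θ) = Real.log (max y θ) - Real.log θ := by
  have hlog := Real.log_nonneg hθ
  unfold pos
  rcases hy.eq_or_lt with rfl | hy0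
  · rw [Real.log_zero, max_eq_right (by linarith : (0 : ℝ) ≤ θ), max_eq_right (by linarith), sub_self]
  · rcases le_total y θ with h | h
    · have := Real.log_le_log hy0 h
      rw [max_eq_right h, max_eq_right (by linarith), sub_self]
    · have := Real.log_le_log (by linarith) h
      rw [max_eq_left h, max_eq_left (by linarith)]

lemma abs_pos_log_sub_le {z z' b x θ D : ℝ} (hz : 0 ≤ z) (hz' : 0 ≤ z') (hb : 0 < b)
    (hθ1 : 1 ≤ θ) (hθ : θ ≤ b * Real.exp (-x)) (hD : |z' - z| ≤ D) (hDθ : D ≤ θ / 2) :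
    |pos (Real.log z - Real.log b + x) - pos (Real.log z' - Real.log b + x)|
      ≤ if θ / 2 < z then D / θ else 0 := by
  have hlog : Real.log (b * Real.exp (-x)) = Real.log b - x := by
    rw [Real.log_mul hb.ne' (Real.exp_pos _).ne', Real.log_exp]
    ring
  have hrw : ∀ y, Real.log y - Real.log b + x = Real.log y - Real.log (b * Real.exp (-x)) := by
    intro y
    rw [hlog]
    ring
  rw [hrw, hrw, pos_log_sub_log hz (hθ1.trans hθ), pos_log_sub_log hz' (hθ1.trans hθ),
    sub_sub_sub_cancel_right]
  have hθ0 : 0 < θ := by linarith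
  split_ifs with h
  · refine (abs_log_sub_log_le hθ0 (hθ.trans (le_max_right _ _))
      (hθ.trans (le_max_right _ _))).trans ?_
    gcongr
    refine (abs_max_sub_max_le_abs z z' _).trans ?_
    rwa [abs_sub_comm]
  · have h1 : z ≤ b * Real.exp (-x) := by linarith
    have h2 : z' ≤ b * Real.exp (-x) := by
      have := (abs_le.1 hD).2
      linarith
    rw [max_eq_right h1, max_eq_right h2, sub_self, abs_zero]

/-- Markov's inequality for the number of exceedances of a level. -/
lemma measureReal_exceedances_le [IsProbabilityMeasure (ℙ : Measure Ω)] {ξ : ℤ → Ω → ℝ}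
    (hξmeas : ∀ i, Measurable (ξ i))
    (hident : ∀ i : ℤ, Measure.map (ξ i) (ℙ : Measure Ω) = Measure.map (ξ 1) (ℙ : Measure Ω))
    (n : ℕ) (u : ℝ) {r : ℝ} (hr : 0 < r) :
    (ℙ : Measure Ω).real
        {ω | r ≤ (((Finset.Icc 1 n).filter fun i : ℕ => u < |ξ (i : ℤ) ω|).card : ℝ)}
      ≤ n * tailDF (Measure.map (fun ω => |ξ 1 ω|) (ℙ : Measure Ω)) u / r := by
  have hset : MeasurableSet {x : ℝ | u < |x|} := measurableSet_lt measurable_const measurable_norm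
  have hms : ∀ i, MeasurableSet {ω | u < |ξ i ω|} := fun i => hξmeas i hset
  have hP : ∀ i : ℤ, (ℙ : Measure Ω).real {ω | u < |ξ i ω|}
      = tailDF (Measure.map (fun ω => |ξ 1 ω|) (ℙ : Measure Ω)) u := by
    intro i
    have h1 : (ℙ : Measure Ω) {ω | u < |ξ i ω|} = (ℙ : Measure Ω) {ω | u < |ξ 1 ω|} := by
      change (ℙ : Measure Ω) (ξ i ⁻¹' {x : ℝ | u < |x|}) = (ℙ : Measure Ω) (ξ 1 ⁻¹' {x : ℝ | u < |x|})
      rw [← Measure.map_apply (hξmeas i) hset, hident, Measure.map_apply (hξmeas 1) hset]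
    have habs : Measurable fun ω => |ξ 1 ω| := (hξmeas 1).norm
    rw [measureReal_def, h1, tailDF, Measure.map_apply habs measurableSet_Ioi]
    rfl
  have hsum : ∀ ω, (((Finset.Icc 1 n).filter fun i : ℕ => u < |ξ (i : ℤ) ω|).card : ℝ)
      = ∑ i ∈ Finset.Icc 1 n, indicator {ω | u < |ξ (i : ℤ) ω|} (fun _ => (1 : ℝ)) ω := by
    intro ω
    rw [Finset.card_filter]
    push_cast
    rfl
  have hint : ∀ i ∈ Finset.Icc 1 n,
      Integrable (indicator {ω | u < |ξ (i : ℤ) ω|} (fun _ => (1 : ℝ))) (ℙ : Measure Ω) :=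
    fun i _ => (integrable_const 1).indicator (hms i)
  rw [le_div_iff₀ hr, mul_comm]
  simp only [hsum]
  refine (mul_meas_ge_le_integral_of_nonneg (ae_of_all _ fun ω =>
    Finset.sum_nonneg fun i _ => indicator_nonneg (fun _ _ => zero_le_one) _)
    (integrable_finsetSum _ hint) r).trans ?_
  rw [integral_finsetSum _ hint]
  refine le_of_eq ?_
  calc ∑ i ∈ Finset.Icc 1 n, ∫ ω, indicator {ω | u < |ξ (i : ℤ) ω|} (fun _ => (1 : ℝ)) ω
      = ∑ i ∈ Finset.Icc 1 n, tailDF (Measure.map (fun ω => |ξ 1 ω|) (ℙ : Measure Ω)) u := by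
        refine Finset.sum_congr rfl fun i _ => ?_
        rw [integral_indicator_const _ (hms i), hP]
        simp
    _ = _ := by simp

/-- In a stable autoregression with Pareto-type innovations of index `α`, the maximum of
`|X_i|` over `-p ≤ i ≤ n` is `O(n^s)` with high probability for every `s > 1/α`. -/
lemma exists_tendsto_measureReal_max [IsProbabilityMeasure (ℙ : Measure Ω)] {X ξ : ℤ → Ω → ℝ}
    (hXmeas : ∀ i, Measurable (X i)) (hξmeas : ∀ i, Measurable (ξ i))
    (hident : ∀ i : ℤ, Measure.map (ξ i) (ℙ : Measure Ω) = Measure.map (ξ 1) (ℙ : Measure Ω))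
    {α : ℝ} (hα : 0 < α) {l : ℝ → ℝ}
    (hB1 : ParetoTail (Measure.map (fun ω => |ξ 1 ω|) (ℙ : Measure Ω)) α l)
    {P : ℂ[X]} (hP : P.eval 0 = 1) (hroot : ∀ z : ℂ, ‖z‖ ≤ 1 → P.eval z ≠ 0)
    (hmodel : ∀ i ω, Polynomial.aeval backshift P (fun j => (X j ω : ℂ)) i = ξ i ω) (p : ℕ) :
    ∃ C : ℝ, 0 < C ∧ ∀ s : ℝ, 1 / α < s → Tendsto (fun n : ℕ => (ℙ : Measure Ω).real
      {ω | ∃ i : ℤ, -(p : ℤ) ≤ i ∧ i ≤ n ∧ C * (n : ℝ) ^ s < |X i ω|}) atTop (nhds 0) := by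
  have hprob : IsProbabilityMeasure (Measure.map (fun ω => |ξ 1 ω|) (ℙ : Measure Ω)) :=
    Measure.isProbabilityMeasure_map (hξmeas 1).norm.aemeasurable
  obtain ⟨C, hC, N, hCN⟩ := exists_bound_of_stable P.natDegree P rfl hP hroot
  refine ⟨2 * C + 1, by positivity, fun s hs => ?_⟩
  have hs0 : 0 < s := lt_trans (by positivity) hs
  set W : Ω → ℝ := fun ω => ∑ i ∈ Finset.Icc (-((max N p : ℕ) : ℤ)) 0, |X i ω| with hW
  have hWm : Measurable W := Finset.measurable_fun_sum _ fun i _ => (hXmeas i).norm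
  have hWlim : Tendsto (fun n : ℕ => (ℙ : Measure Ω).real {ω | (n : ℝ) ^ s < W ω}) atTop
      (nhds 0) := by
    refine tendsto_order.2 ⟨fun a ha => Eventually.of_forall fun n =>
      ha.trans_le measureReal_nonneg, fun η hη => ?_⟩
    obtain ⟨t, ht⟩ := exists_measureReal_lt hWm hη
    filter_upwards [((tendsto_rpow_atTop hs0).comp tendsto_natCast_atTop_atTop).eventually
      (eventually_ge_atTop t)] with n hn
    exact ht _ hn
  have hlim := (hB1.tendsto_nat_mul_tailDF hα hs).add hWlim
  rw [add_zero] at hlim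
  refine squeeze_zero (fun n => measureReal_nonneg) (fun n => ?_) hlim
  have h1 := measureReal_exceedances_le hξmeas hident n ((n : ℝ) ^ s) one_pos
  rw [div_one] at h1
  refine le_trans (measureReal_mono ?_) ((measureReal_union_le
    {ω | (1 : ℝ) ≤ (((Finset.Icc 1 n).filter fun i : ℕ => (n : ℝ) ^ s < |ξ (i : ℤ) ω|).card : ℝ)}
    {ω | (n : ℝ) ^ s < W ω}).trans (by gcongr))
  rintro ω ⟨i, hi1, hi2, hi3⟩
  by_contra hcon
  simp only [mem_union, mem_ofPred_eq, not_or, not_le, not_lt] at hcon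
  obtain ⟨hξ, hWω⟩ := hcon
  have hcard : ((Finset.Icc 1 n).filter fun i : ℕ => (n : ℝ) ^ s < |ξ (i : ℤ) ω|).card = 0 := by
    have : ((Finset.Icc 1 n).filter fun i : ℕ => (n : ℝ) ^ s < |ξ (i : ℤ) ω|).card < 1 := by
      exact_mod_cast hξ
    omega
  rw [Finset.card_eq_zero, Finset.filter_eq_empty_iff] at hcard
  have hns : (0 : ℝ) ≤ (n : ℝ) ^ s := by positivity
  have hinit : ∀ j : ℤ, -((max N p : ℕ) : ℤ) ≤ j → j ≤ 0 → |X j ω| ≤ (n : ℝ) ^ s := by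
    intro j hj hj0
    refine le_trans ?_ hWω
    exact Finset.single_le_sum (f := fun j => |X j ω|) (fun i _ => abs_nonneg _)
      (Finset.mem_Icc.2 ⟨hj, hj0⟩)
  rcases le_or_gt i 0 with hi0 | hi0
  · have := hinit i (by push_cast; omega) hi0
    nlinarith
  · have hb := hCN (fun j => (X j ω : ℂ)) n ((n : ℝ) ^ s) ((n : ℝ) ^ s) hns hns
      (fun j hj1 hj2 => by
        rw [hmodel, Complex.norm_real]
        have := hcard (x := j.toNat) (Finset.mem_Icc.2 (by omega))
        rw [Int.toNat_of_nonneg (by omega)] at this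
        exact not_lt.1 this)
      (fun j hj1 hj2 => by
        rw [Complex.norm_real]
        exact hinit j (by push_cast; omega) hj2) i (by omega) hi2
    rw [Complex.norm_real, Real.norm_eq_abs] at hb
    linarith

omit [MeasureSpace Ω] in
lemma abs_Zhat_sub_le {p : ℕ} {φc : Fin p → ℝ} {X ξ : ℤ → Ω → ℝ}
    (hmodel : ∀ (i : ℤ) ω, X i ω = ∑ j : Fin p, φc j * X (i - ((j : ℕ) + 1)) ω + ξ i ω)
    (φh : Ω → Fin p → ℝ) (ω : Ω) (i : ℕ) {M : ℝ}
    (hM : ∀ j : Fin p, |X ((i : ℤ) - ((j : ℕ) + 1)) ω| ≤ M) :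
    |Zhat p X φh i ω - (|ξ i ω|)| ≤ p * (‖(fun j => φh ω j - φc j : Fin p → ℝ)‖ * M) := by
  refine (abs_abs_sub_abs_le_abs_sub _ _).trans ?_
  have h1 : residual p X φh i ω - ξ i ω
      = -∑ j : Fin p, (φh ω j - φc j) * X ((i : ℤ) - ((j : ℕ) + 1)) ω := by
    simp only [sub_mul, Finset.sum_sub_distrib]
    rw [residual]
    linarith [hmodel i ω]
  rw [h1, abs_neg]
  refine (Finset.abs_sum_le_sum_abs _ _).trans ?_
  calc ∑ j : Fin p, |(φh ω j - φc j) * X ((i : ℤ) - ((j : ℕ) + 1)) ω|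
      ≤ ∑ _j : Fin p, ‖(fun j => φh ω j - φc j : Fin p → ℝ)‖ * M := by
        refine Finset.sum_le_sum fun j _ => ?_
        rw [abs_mul]
        exact mul_le_mul (norm_le_pi_norm (fun j => φh ω j - φc j : Fin p → ℝ) j) (hM j)
          (abs_nonneg _) (norm_nonneg _)
    _ = _ := by simp

/-- Lemma 9 of Kim–Lee (2009): under (B1)–(B4) and `k^{1/α+1/2}/d(n) = o(n^{-ν})`,
for all `c < d`, `k^{-1/2} sup_{x∈[c,d]} Σ_{i=1}^n |(log Z_i - log b*(n/k) + x)₊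
- (log Ẑ_i - log b*(n/k) + x)₊| = o_P(1)`. -/
theorem residual_pos_part_comparison
    {Ω : Type*} [MeasureSpace Ω] [IsProbabilityMeasure (ℙ : Measure Ω)]
    (p : ℕ) (φc : Fin p → ℝ) (X ξ : ℤ → Ω → ℝ)
    (hXmeas : ∀ i, Measurable (X i)) (hξmeas : ∀ i, Measurable (ξ i))
    (hmodel : ∀ (i : ℤ) ω, X i ω = ∑ j : Fin p, φc j * X (i - ((j : ℕ) + 1)) ω + ξ i ω)
    (hchar : ∀ z : ℂ, ‖z‖ < 1 →
      (1 : ℂ) - ∑ j : Fin p, (φc j : ℂ) * z ^ ((j : ℕ) + 1) ≠ 0)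
    (hstat : IsStationaryZ X)
    (hindep : iIndepFun (m := fun _ : ℤ => Real.measurableSpace) ξ (ℙ : Measure Ω))
    (hident : ∀ i : ℤ, Measure.map (ξ i) (ℙ : Measure Ω) = Measure.map (ξ 1) (ℙ : Measure Ω))
    (α : ℝ) (hα : 0 < α) (lstar : ℝ → ℝ)
    (hB1 : ParetoTail (Measure.map (fun ω => |ξ 1 ω|) (ℙ : Measure Ω)) α lstar)
    (g : ℝ → ℝ) (Kκ γ : ℝ) (hB2 : SecondOrderRV lstar g Kκ γ)
    (k : ℕ → ℕ) (hk : TailFraction k)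
    (hB3 : Tendsto (fun n : ℕ => Real.sqrt (k n) * g ((quantileB (Measure.map (fun ω => |ξ 1 ω|) (ℙ : Measure Ω))) ((n : ℝ) / k n)))
      atTop (nhds 0))
    (φhat : ℕ → Ω → Fin p → ℝ) (hφhat : ∀ n, Measurable (φhat n))
    (d : ℕ → ℝ) (hd : Tendsto d atTop atTop)
    (hdb : Tendsto (fun n : ℕ =>
        (Real.sqrt (k n) * (quantileB (Measure.map (fun ω => |ξ 1 ω|) (ℙ : Measure Ω))) ((n : ℝ) / Real.sqrt (k n)) / (quantileB (Measure.map (fun ω => |ξ 1 ω|) (ℙ : Measure Ω))) ((n : ℝ) / k n)) / d n)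
      atTop (nhds 0))
    (hB4 : BddInProb (fun n ω => d n * ‖(fun j => φhat n ω j - φc j : Fin p → ℝ)‖))
    (hkd : (∃ ν : ℝ, 0 < ν ∧
      Tendsto (fun n : ℕ => ((k n : ℝ) ^ ((1 : ℝ) / α + 1 / 2) / d n) * (n : ℝ) ^ ν)
        atTop (nhds 0))) :
    ∀ c dd : ℝ, c < dd →
      TendstoInMeasure (ℙ : Measure Ω)
        (fun n ω => (Real.sqrt (k n))⁻¹ *
          ⨆ x : Icc c dd, ∑ i ∈ Finset.Icc 1 n,
            |pos (Real.log |ξ (i : ℤ) ω| - Real.log ((quantileB (Measure.map (fun ω => |ξ 1 ω|) (ℙ : Measure Ω))) ((n : ℝ) / k n)) + (x : ℝ))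
              - pos (Real.log (Zhat p X (φhat n) i ω)
                - Real.log ((quantileB (Measure.map (fun ω => |ξ 1 ω|) (ℙ : Measure Ω))) ((n : ℝ) / k n)) + (x : ℝ))|)
        atTop 0 := by
  intro c dd hcd
  have habs : Measurable fun ω => |ξ 1 ω| := (hξmeas 1).norm
  have hprob : IsProbabilityMeasure (Measure.map (fun ω => |ξ 1 ω|) (ℙ : Measure Ω)) :=
    Measure.isProbabilityMeasure_map habs.aemeasurable
  set μ : Measure ℝ := Measure.map (fun ω => |ξ 1 ω|) (ℙ : Measure Ω) with hμ
  have hunb : ∀ M : ℝ, 0 < (ℙ : Measure Ω).real {ω | M < |ξ 1 ω|} := by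
    intro M
    have := hB1.tailDF_pos M
    rwa [tailDF, hμ, Measure.map_apply habs measurableSet_Ioi] at this
  have hP1 : (arPoly φc).eval 0 = 1 := by simp [arPoly_eval]
  have hmodelB : ∀ i ω, Polynomial.aeval backshift (arPoly φc) (fun j => (X j ω : ℂ)) i
      = ξ i ω := by
    intro i ω
    rw [aeval_arPoly, hmodel i ω]
    push_cast
    ring
  have hroot : ∀ z : ℂ, ‖z‖ ≤ 1 → (arPoly φc).eval z ≠ 0 := by
    intro z hz
    rcases hz.lt_or_eq with h | h
    · rw [arPoly_eval]
      exact hchar z h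
    · exact eval_ne_zero_of_isStationaryZ hXmeas hξmeas hstat hindep hident hunb hP1 hmodelB h
  obtain ⟨C, hC, hmax⟩ :=
    exists_tendsto_measureReal_max hXmeas hξmeas hident hα hB1 hP1 hroot hmodelB p
  obtain ⟨ν, hν, hkd⟩ := hkd
  set δ := Real.exp (-dd) with hδ
  have hδ0 : 0 < δ := Real.exp_pos _
  obtain ⟨C₁, hC₁, hcount⟩ := hB1.exists_mul_tailDF_quantileB_le hα (half_pos hδ0)
  set b : ℕ → ℝ := fun n => quantileB μ ((n : ℝ) / k n) with hb
  set s : ℝ := 1 / α + ν / 2 with hs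
  have hαinv : 0 < 1 / α := by positivity
  obtain ⟨β, hβ0, hβα, hβν⟩ : ∃ β, 0 < β ∧ β < 1 / α ∧ s ≤ ν + β := by
    refine ⟨1 / α - min (ν / 2) (1 / (2 * α)), ?_, ?_, ?_⟩
    · have : 1 / (2 * α) < 1 / α := by gcongr; linarith
      linarith [min_le_right (ν / 2) (1 / (2 * α))]
    · have : 0 < min (ν / 2) (1 / (2 * α)) := by positivity
      linarith
    · linarith [min_le_left (ν / 2) (1 / (2 * α))]
  have hkpos : ∀ᶠ n in atTop, (1 : ℝ) ≤ k n := hk.1.eventually (eventually_ge_atTop 1)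
  have hy : Tendsto (fun n : ℕ => (n : ℝ) / k n) atTop atTop := by
    have h0 : Tendsto (fun n : ℕ => (k n : ℝ) / n) atTop (nhdsWithin 0 (Ioi 0)) := by
      refine tendsto_nhdsWithin_iff.2 ⟨hk.2, ?_⟩
      filter_upwards [hkpos, eventually_gt_atTop 0] with n hkn hn
      have : (0 : ℝ) < n := by exact_mod_cast hn
      exact div_pos (by linarith) this
    refine h0.inv_tendsto_nhdsGT_zero.congr fun n => ?_
    simp
  have hbtop : Tendsto b atTop atTop := (hB1.tendsto_quantileB hα).comp hy
  rw [tendstoInMeasure_iff_measureReal_norm]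
  intro ε hε
  refine tendsto_order.2 ⟨fun a ha => Eventually.of_forall fun n =>
      ha.trans_le measureReal_nonneg, fun η hη => ?_⟩
  obtain ⟨K₀, hK₀⟩ := hB4 (η / 4) (by positivity)
  set K := max K₀ 0 with hK
  have hK0 : 0 ≤ K := le_max_right _ _
  set r : ℝ := 4 * C₁ / η with hr
  have hr0 : 0 < r := by positivity
  set ρ : ℕ → ℝ := fun n =>
    p * K * C * (((k n : ℝ) ^ ((1 : ℝ) / α + 1 / 2) / d n) * (n : ℝ) ^ ν) with hρ
  have hρlim : Tendsto ρ atTop (nhds 0) := by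
    have h := hkd.const_mul ((p : ℝ) * K * C)
    rwa [mul_zero] at h
  have hρr : Tendsto (fun n => ρ n * r / δ) atTop (nhds 0) := by
    simpa using (hρlim.mul_const r).div_const δ
  filter_upwards [hK₀, hkpos, eventually_gt_atTop 0, hd.eventually (eventually_gt_atTop 0),
    hy.eventually hcount, hy.eventually (hB1.eventually_rpow_le_quantileB hα hβ0 hβα),
    hbtop.eventually (eventually_ge_atTop δ⁻¹), hρlim.eventually (gt_mem_nhds (half_pos hδ0)),
    hρr.eventually (gt_mem_nhds hε),
    (hmax s (by rw [hs]; linarith)).eventually (gt_mem_nhds (show 0 < η / 4 by positivity))]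
    with n hnK hkn hn0 hdn hcn hβn hbn hρn hρrn hmn
  have hn1 : (1 : ℝ) ≤ n := by exact_mod_cast hn0
  have hnpos : (0 : ℝ) < n := by linarith
  have hkn0 : (0 : ℝ) < k n := by linarith
  have hbn0 : 0 < b n := (inv_pos.2 hδ0).trans_le hbn
  have hρ0 : 0 ≤ ρ n := by positivity
  have hθ1 : 1 ≤ δ * b n := by
    have := mul_le_mul_of_nonneg_left hbn hδ0.le
    rwa [mul_inv_cancel₀ hδ0.ne'] at this
  have hsq : 1 ≤ Real.sqrt (k n) := Real.one_le_sqrt.2 hkn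
  have hsq0 : 0 < Real.sqrt (k n) := by linarith
  set D : ℝ := ρ n * b n / Real.sqrt (k n) with hD
  have hDθ : D ≤ δ * b n / 2 := by
    rw [hD, div_le_iff₀ hsq0]
    calc ρ n * b n ≤ δ / 2 * b n := by gcongr
      _ = δ * b n / 2 * 1 := by ring
      _ ≤ δ * b n / 2 * Real.sqrt (k n) := by gcongr
  have hpow : (n : ℝ) ^ s ≤ (k n : ℝ) ^ ((1 : ℝ) / α) * (n : ℝ) ^ ν * b n := by
    calc (n : ℝ) ^ s ≤ (n : ℝ) ^ (ν + β) := Real.rpow_le_rpow_of_exponent_le hn1 hβν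
      _ = 1 * ((n : ℝ) ^ ν * (n : ℝ) ^ β) := by rw [Real.rpow_add hnpos, one_mul]
      _ ≤ (k n : ℝ) ^ (1 / α - β) * ((n : ℝ) ^ ν * (n : ℝ) ^ β) := by
          gcongr
          exact Real.one_le_rpow hkn (by linarith)
      _ = (k n : ℝ) ^ ((1 : ℝ) / α) * (n : ℝ) ^ ν * ((n : ℝ) / k n) ^ β := by
          rw [Real.rpow_sub hkn0, Real.div_rpow hnpos.le hkn0.le]
          ring
      _ ≤ _ := by gcongr
  have hDbound : p * (K / d n * (C * (n : ℝ) ^ s)) ≤ D := by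
    have hsplit : (k n : ℝ) ^ ((1 : ℝ) / α + 1 / 2)
        = (k n : ℝ) ^ ((1 : ℝ) / α) * Real.sqrt (k n) := by
      rw [Real.rpow_add hkn0, Real.sqrt_eq_rpow]
    calc p * (K / d n * (C * (n : ℝ) ^ s))
        ≤ p * (K / d n * (C * ((k n : ℝ) ^ ((1 : ℝ) / α) * (n : ℝ) ^ ν * b n))) := by gcongr
      _ = D := by
          rw [hD, hρ]
          simp only
          rw [hsplit]
          field_simp
  set bad₁ : Set Ω := {ω | K₀ < |d n * ‖(fun j => φhat n ω j - φc j : Fin p → ℝ)‖|}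
  set bad₂ : Set Ω := {ω | ∃ i : ℤ, -(p : ℤ) ≤ i ∧ i ≤ n ∧ C * (n : ℝ) ^ s < |X i ω|}
  set bad₃ : Set Ω := {ω | r * k n ≤
    (((Finset.Icc 1 n).filter fun i : ℕ => δ / 2 * b n < |ξ (i : ℤ) ω|).card : ℝ)}
  have hbad₃ : (ℙ : Measure Ω).real bad₃ ≤ η / 4 := by
    refine (measureReal_exceedances_le hξmeas hident n _ (by positivity)).trans ?_
    rw [div_le_iff₀ (by positivity)]
    have h1 : (n : ℝ) * tailDF μ (δ / 2 * b n)
        = k n * ((n : ℝ) / k n * tailDF μ (δ / 2 * b n)) := by field_simp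
    calc (n : ℝ) * tailDF μ (δ / 2 * b n)
        = k n * ((n : ℝ) / k n * tailDF μ (δ / 2 * b n)) := h1
      _ ≤ k n * C₁ := by gcongr
      _ = η / 4 * (r * k n) := by rw [hr]; field_simp
  have hbad : (ℙ : Measure Ω).real (bad₁ ∪ bad₂ ∪ bad₃) < η := by
    have h1 := measureReal_union_le (μ := (ℙ : Measure Ω)) (bad₁ ∪ bad₂) bad₃
    have h2 := measureReal_union_le (μ := (ℙ : Measure Ω)) bad₁ bad₂
    have h3 : (ℙ : Measure Ω).real bad₁ < η / 4 := hnK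
    linarith
  refine lt_of_le_of_lt (measureReal_mono fun ω hω => ?_) hbad
  by_contra hgood
  simp only [mem_union, not_or] at hgood
  obtain ⟨⟨hg₁, hg₂⟩, hg₃⟩ := hgood
  have hU : ‖(fun j => φhat n ω j - φc j : Fin p → ℝ)‖ ≤ K / d n := by
    rw [le_div_iff₀ hdn, mul_comm]
    exact (le_abs_self _).trans ((not_lt.1 hg₁).trans (le_max_left _ _))
  have hXb : ∀ i : ℤ, -(p : ℤ) ≤ i → i ≤ n → |X i ω| ≤ C * (n : ℝ) ^ s := fun i h1 h2 =>
    not_lt.1 fun h => hg₂ ⟨i, h1, h2, h⟩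
  have hZ : ∀ i ∈ Finset.Icc 1 n, |Zhat p X (φhat n) i ω - (|ξ i ω|)| ≤ D := by
    intro i hi
    rw [Finset.mem_Icc] at hi
    refine (abs_Zhat_sub_le hmodel (φhat n) ω i fun j => hXb _ ?_ ?_).trans
      (le_trans (by gcongr) hDbound)
    · have := j.2
      omega
    · omega
  set cnt : ℝ := (((Finset.Icc 1 n).filter fun i : ℕ => δ / 2 * b n < |ξ (i : ℤ) ω|).card : ℝ)
    with hcnt
  have hcntlt : cnt < r * k n := not_le.1 hg₃
  have hsup : (⨆ x : Icc c dd, ∑ i ∈ Finset.Icc 1 n,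
      |pos (Real.log |ξ (i : ℤ) ω| - Real.log (b n) + (x : ℝ))
        - pos (Real.log (Zhat p X (φhat n) i ω) - Real.log (b n) + (x : ℝ))|)
      ≤ cnt * (D / (δ * b n)) := by
    have : Nonempty (Icc c dd) := ⟨⟨c, le_rfl, hcd.le⟩⟩
    refine ciSup_le fun x => ?_
    calc _ ≤ ∑ i ∈ Finset.Icc 1 n,
          (if δ * b n / 2 < |ξ (i : ℤ) ω| then D / (δ * b n) else 0) := by
          refine Finset.sum_le_sum fun i hi => ?_
          refine abs_pos_log_sub_le (abs_nonneg _) (abs_nonneg _) hbn0 hθ1 ?_ (hZ i hi) hDθ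
          rw [mul_comm, hδ]
          gcongr
          exact x.2.2
      _ = _ := by
          rw [← Finset.sum_filter, Finset.sum_const, nsmul_eq_mul, hcnt,
            show δ * b n / 2 = δ / 2 * b n by ring]
  have hle : ε ≤ (Real.sqrt (k n))⁻¹ * (cnt * (D / (δ * b n))) := by
    refine le_trans ?_ (mul_le_mul_of_nonneg_left hsup (inv_nonneg.2 hsq0.le))
    have hω' := hω
    simp only [mem_ofPred_eq, Pi.zero_apply, sub_zero, Real.norm_eq_abs] at hω'
    rwa [abs_of_nonneg] at hω'
    exact mul_nonneg (inv_nonneg.2 hsq0.le)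
      (Real.iSup_nonneg fun x => Finset.sum_nonneg fun i _ => abs_nonneg _)
  have hval : (Real.sqrt (k n))⁻¹ * (cnt * (D / (δ * b n))) = cnt * ρ n / (k n * δ) := by
    have hss : (k n : ℝ) = Real.sqrt (k n) * Real.sqrt (k n) :=
      (Real.mul_self_sqrt hkn0.le).symm
    rw [hD, hss, Real.sqrt_mul_self hsq0.le]
    field_simp
  have hfin : cnt * ρ n / (k n * δ) ≤ ρ n * r / δ := by
    calc cnt * ρ n / (k n * δ) ≤ r * k n * ρ n / (k n * δ) := by gcongr
      _ = ρ n * r / δ := by field_simp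
  linarith

end TailCusum
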